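/- Let G = (V,E,w) be a finite undirected graph with positive edge weights, and run the LOWD iterative process from the equal-split initialization. Then the value Σ_{v∈V} ℓ_v² after t iterations converges, as t → ∞, to the minimum of Σ_{v∈V} ℓ_v(f)² over all edge-weight distributions f on G. -/

import Mathlib

open Finset

noncomputable section

variable {V : Type*} [Fintype V] [DecidableEq V]

/-- Total weight `W(S)` of edges with both endpoints in `S`
(for a symmetric weight function with zero diagonal). -/
def wgt (w : V → V → ℝ) (S : Finset V) : ℝ := (∑ u ∈ S, ∑ v ∈ S, w u v) / 2

/-- Density `ρ(S) = W(S)/|S|` of the subgraph induced by `S`. -/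
def density (w : V → V → ℝ) (S : Finset V) : ℝ := wgt w S / S.card

/-- Weighted degree of `u` within `S`. -/
def wdeg (w : V → V → ℝ) (S : Finset V) (u : V) : ℝ := ∑ v ∈ S, w u v

/-- `f` is an edge-weight distribution for the weight function `w`:
`f u v` is the share of the weight of edge `{u,v}` assigned to `u`. -/
def IsDistrib (w f : V → V → ℝ) : Prop :=
  (∀ u v, 0 ≤ f u v) ∧ (∀ u v, f u v + f v u = w u v)

/-- Load `ℓ_v` of vertex `v` under the distribution `f`. -/
def load (f : V → V → ℝ) (v : V) : ℝ := ∑ u, f v u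

/-- Transfer `d` units of the weight of edge `{u,v}` from `u`'s share to `v`'s share. -/
def lowdTransfer (f : V → V → ℝ) (u v : V) (d : ℝ) : V → V → ℝ :=
  fun x y =>
    if x = u ∧ y = v then f u v - d
    else if x = v ∧ y = u then f v u + d
    else f x y

/-- The LOWD update on the edge `p = (u,v)`: with `ℓ_u ≥ ℓ_v`, transfer
`d = min{(ℓ_u − ℓ_v)/2, f_e(u)}` from `u`'s share to `v`'s share. -/
def lowdStep (f : V → V → ℝ) (p : V × V) : V → V → ℝ :=
  if load f p.2 ≤ load f p.1 then
    lowdTransfer f p.1 p.2 (min ((load f p.1 - load f p.2) / 2) (f p.1 p.2))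
  else
    lowdTransfer f p.2 p.1 (min ((load f p.2 - load f p.1) / 2) (f p.2 p.1))

/-- One LOWD iteration: process every edge of the list `es` once,
in the fixed order given by `es`, applying the update sequentially. -/
def lowdIter (es : List (V × V)) (f : V → V → ℝ) : V → V → ℝ :=
  es.foldl lowdStep f

/-- The LOWD iterative process started from the equal-split
initialization `f_e(u) = f_e(v) = w_e / 2`. -/
def lowdSeq (w : V → V → ℝ) (es : List (V × V)) (t : ℕ) : V → V → ℝ :=
  (lowdIter es)^[t] (fun u v => w u v / 2)

/-- The list `es` enumerates each (undirected, loopless, positive-weight) edge of `w`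
exactly once. -/
def EnumeratesEdges (w : V → V → ℝ) (es : List (V × V)) : Prop :=
  es.Nodup ∧
  (∀ p ∈ es, p.1 ≠ p.2 ∧ 0 < w p.1 p.2) ∧
  (∀ p ∈ es, (p.2, p.1) ∉ es) ∧
  (∀ u v : V, u ≠ v → 0 < w u v → (u, v) ∈ es ∨ (v, u) ∈ es)

/-- `D_t`: the maximum vertex load after `t` LOWD iterations. -/
def Dseq [Nonempty V] (w : V → V → ℝ) (es : List (V × V)) (t : ℕ) : ℝ :=
  Finset.univ.sup' Finset.univ_nonempty (load (lowdSeq w es t))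

/-- Sum of squared loads. -/
def phiSq (f : V → V → ℝ) : ℝ := ∑ v, (load f v) ^ 2

/-- The signed amount moved from `p.1` to `p.2`. -/
def clampD (f : V → V → ℝ) (p : V × V) : ℝ :=
  max (min ((load f p.1 - load f p.2) / 2) (f p.1 p.2)) (-(f p.2 p.1))

/-- Globally continuous version of `lowdStep`. -/
def stepC (f : V → V → ℝ) (p : V × V) : V → V → ℝ :=
  lowdTransfer f p.1 p.2 (clampD f p)

omit [Fintype V] in
lemma transfer_swap (f : V → V → ℝ) (u v : V) (h : u ≠ v) (d : ℝ) :
    lowdTransfer f v u d = lowdTransfer f u v (-d) := by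
  funext x y
  unfold lowdTransfer
  split_ifs <;> grind

lemma lowdStep_eq (f : V → V → ℝ) (hf : ∀ u v, 0 ≤ f u v) (p : V × V) (hp : p.1 ≠ p.2) :
    lowdStep f p = stepC f p := by
  have h1 := hf p.1 p.2
  have h2 := hf p.2 p.1
  unfold lowdStep stepC clampD
  split_ifs with h
  · rw [max_eq_left]
    have : 0 ≤ min ((load f p.1 - load f p.2) / 2) (f p.1 p.2) :=
      le_min (by linarith) h1
    linarith
  · push Not at h
    rw [transfer_swap _ _ _ hp]
    congr 1
    rw [min_eq_left (by linarith : (load f p.1 - load f p.2) / 2 ≤ f p.1 p.2)]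
    rw [← max_neg_neg]
    congr 1
    ring

lemma load_transfer (f : V → V → ℝ) (u v : V) (h : u ≠ v) (d : ℝ) (x : V) :
    load (lowdTransfer f u v d) x
      = load f x + ((if x = v then d else 0) - (if x = u then d else 0)) := by
  have key : ∀ y, lowdTransfer f u v d x y = f x y +
      ((if y = u then (if x = v then d else 0) else 0)
        - (if y = v then (if x = u then d else 0) else 0)) := by
    intro y
    unfold lowdTransfer
    split_ifs <;> grind
  unfold load
  simp only [key, Finset.sum_add_distrib, Finset.sum_sub_distrib, Finset.sum_ite_eq',
    Finset.mem_univ, if_true]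

lemma phiSq_transfer (f : V → V → ℝ) (u v : V) (h : u ≠ v) (d : ℝ) :
    phiSq (lowdTransfer f u v d)
      = phiSq f - 2 * d * (load f u - load f v) + 2 * d ^ 2 := by
  have key : ∀ x, (load (lowdTransfer f u v d) x) ^ 2 = (load f x) ^ 2 +
      ((if x = v then (2 * d * load f v + d ^ 2) else 0)
        + (if x = u then (d ^ 2 - 2 * d * load f u) else 0)) := by
    intro x
    rw [load_transfer f u v h d x]
    by_cases hv : x = v
    · have hu : x ≠ u := fun hu => h (hu.symm.trans hv)
      rw [if_pos hv, if_neg hu, if_pos hv, if_neg hu, hv]; ring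
    · by_cases hu : x = u
      · rw [if_neg hv, if_pos hu, if_neg hv, if_pos hu, hu]; ring
      · rw [if_neg hv, if_neg hu, if_neg hv, if_neg hu]; ring
  unfold phiSq
  simp only [key, Finset.sum_add_distrib, Finset.sum_ite_eq', Finset.mem_univ, if_true]
  ring

lemma phiSq_stepC (f : V → V → ℝ) (hf : ∀ u v, 0 ≤ f u v) (p : V × V) (hp : p.1 ≠ p.2) :
    phiSq (stepC f p) + 2 * (clampD f p) ^ 2 ≤ phiSq f := by
  unfold stepC
  rw [phiSq_transfer _ _ _ hp]
  have h1 := hf p.1 p.2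
  have h2 := hf p.2 p.1
  rcases le_total (load f p.2) (load f p.1) with h | h
  · have ha : 0 ≤ clampD f p := le_max_of_le_left (le_min (by linarith) h1)
    have hb : clampD f p ≤ (load f p.1 - load f p.2) / 2 :=
      max_le (min_le_left _ _) (by linarith)
    nlinarith
  · have ha : clampD f p ≤ 0 :=
      max_le ((min_le_left _ _).trans (by linarith)) (by linarith)
    have hb : (load f p.1 - load f p.2) / 2 ≤ clampD f p :=
      le_max_of_le_left (le_min le_rfl (by linarith))
    nlinarith

lemma stepC_distrib (w f : V → V → ℝ) (hf : IsDistrib w f) (p : V × V) (hp : p.1 ≠ p.2) :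
    IsDistrib w (stepC f p) := by
  obtain ⟨h0, hw⟩ := hf
  have ha : clampD f p ≤ f p.1 p.2 :=
    max_le (min_le_right _ _) (by linarith [h0 p.1 p.2, h0 p.2 p.1])
  have hb : -(f p.2 p.1) ≤ clampD f p := le_max_right _ _
  unfold stepC
  generalize clampD f p = d at *
  constructor
  · intro x y
    have := h0 x y
    unfold lowdTransfer
    split_ifs <;> linarith
  · intro x y
    have := hw x y
    unfold lowdTransfer
    split_ifs <;> grind

lemma fold_eq (w : V → V → ℝ) (es : List (V × V)) (hes : ∀ p ∈ es, p.1 ≠ p.2)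
    (f : V → V → ℝ) (hf : IsDistrib w f) :
    es.foldl lowdStep f = es.foldl stepC f := by
  induction es generalizing f with
  | nil => rfl
  | cons p es ih =>
    have hp := hes p (by simp)
    simp only [List.foldl_cons]
    rw [lowdStep_eq f hf.1 p hp]
    exact ih (fun q hq => hes q (by simp [hq])) _ (stepC_distrib w f hf p hp)

lemma fold_distrib (w : V → V → ℝ) (es : List (V × V)) (hes : ∀ p ∈ es, p.1 ≠ p.2)
    (f : V → V → ℝ) (hf : IsDistrib w f) : IsDistrib w (es.foldl stepC f) := by
  induction es generalizing f with
  | nil => exact hf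
  | cons p es ih =>
    exact ih (fun q hq => hes q (by simp [hq])) _ (stepC_distrib w f hf p (hes p (by simp)))

lemma fold_phi_le (w : V → V → ℝ) (es : List (V × V)) (hes : ∀ p ∈ es, p.1 ≠ p.2)
    (f : V → V → ℝ) (hf : IsDistrib w f) : phiSq (es.foldl stepC f) ≤ phiSq f := by
  induction es generalizing f with
  | nil => exact le_rfl
  | cons p es ih =>
    have hp := hes p (by simp)
    have h1 := ih (fun q hq => hes q (by simp [hq])) _ (stepC_distrib w f hf p hp)
    have h2 := phiSq_stepC f hf.1 p hp
    simp only [List.foldl_cons]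
    nlinarith [sq_nonneg (clampD f p)]

lemma fold_phi_eq (w : V → V → ℝ) (es : List (V × V)) (hes : ∀ p ∈ es, p.1 ≠ p.2)
    (f : V → V → ℝ) (hf : IsDistrib w f) (heq : phiSq (es.foldl stepC f) = phiSq f) :
    ∀ p ∈ es, clampD f p = 0 := by
  induction es generalizing f with
  | nil => simp
  | cons p es ih =>
    have hp := hes p (by simp)
    have hes' : ∀ q ∈ es, q.1 ≠ q.2 := fun q hq => hes q (by simp [hq])
    have h1 := fold_phi_le w es hes' _ (stepC_distrib w f hf p hp)
    have h2 := phiSq_stepC f hf.1 p hp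
    simp only [List.foldl_cons] at heq
    have hd : clampD f p = 0 := by
      have : (clampD f p) ^ 2 = 0 := le_antisymm (by linarith) (sq_nonneg _)
      simpa using this
    have hs : stepC f p = f := by
      unfold stepC
      rw [hd]
      funext x y
      unfold lowdTransfer
      split_ifs <;> grind
    rw [hs] at heq
    intro q hq
    rcases List.mem_cons.1 hq with rfl | hq
    · exact hd
    · exact ih hes' f hf heq q hq

omit [DecidableEq V] in
lemma clampD_zero (f : V → V → ℝ) (hf : ∀ u v, 0 ≤ f u v) (p : V × V) (h : clampD f p = 0) :
    (load f p.2 < load f p.1 → f p.1 p.2 = 0) ∧ (load f p.1 < load f p.2 → f p.2 p.1 = 0) := by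
  have h1 := hf p.1 p.2
  have h2 := hf p.2 p.1
  unfold clampD at h
  constructor
  · intro hl
    have : min ((load f p.1 - load f p.2) / 2) (f p.1 p.2) ≤ 0 := h ▸ le_max_left _ _
    rcases min_le_iff.1 this with h' | h' <;> linarith
  · intro hl
    by_contra hne
    have : 0 < f p.2 p.1 := lt_of_le_of_ne h2 (Ne.symm hne)
    have hlt : max (min ((load f p.1 - load f p.2) / 2) (f p.1 p.2)) (-(f p.2 p.1)) < 0 :=
      max_lt (min_lt_of_left_lt (by linarith)) (by linarith)
    linarith

omit [DecidableEq V] in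
lemma opt_of_stable (w f g : V → V → ℝ) (hf : IsDistrib w f) (hg : IsDistrib w g)
    (hs : ∀ u v, load f v < load f u → f u v = 0) : phiSq f ≤ phiSq g := by
  have e1 : ∑ v, load f v * (load g v - load f v) = ∑ u, ∑ v, load f u * (g u v - f u v) := by
    refine Finset.sum_congr rfl fun u _ => ?_
    rw [← Finset.mul_sum, Finset.sum_sub_distrib]
    rfl
  have e2 : ∑ u, ∑ v, load f u * (g u v - f u v) = ∑ u, ∑ v, -(load f v * (g u v - f u v)) := by
    rw [Finset.sum_comm]
    refine Finset.sum_congr rfl fun u _ => Finset.sum_congr rfl fun v _ => ?_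
    have a := hf.2 u v
    have b := hg.2 u v
    have : g v u - f v u = -(g u v - f u v) := by linarith
    rw [this]; ring
  have e3 : 0 ≤ ∑ u, ∑ v, (load f u - load f v) * (g u v - f u v) := by
    refine Finset.sum_nonneg fun u _ => Finset.sum_nonneg fun v _ => ?_
    have a := hf.2 u v
    have b := hg.2 u v
    have c := hg.1 u v
    have d := hg.1 v u
    rcases lt_trichotomy (load f u) (load f v) with h | h | h
    · have := hs v u h
      exact mul_nonneg_of_nonpos_of_nonpos (by linarith) (by linarith)
    · rw [h]; simp
    · have := hs u v h
      exact mul_nonneg (by linarith) (by linarith)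
  have e4 : ∑ u, ∑ v, (load f u - load f v) * (g u v - f u v)
      = ∑ u, ∑ v, load f u * (g u v - f u v) + ∑ u, ∑ v, -(load f v * (g u v - f u v)) := by
    simp only [← Finset.sum_add_distrib]
    refine Finset.sum_congr rfl fun u _ => Finset.sum_congr rfl fun v _ => ?_
    ring
  have e5 : phiSq g - phiSq f
      = 2 * ∑ v, load f v * (load g v - load f v) + ∑ v, (load g v - load f v) ^ 2 := by
    unfold phiSq
    rw [Finset.mul_sum, ← Finset.sum_sub_distrib, ← Finset.sum_add_distrib]
    refine Finset.sum_congr rfl fun v _ => ?_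
    ring
  have e6 : 0 ≤ ∑ v, (load g v - load f v) ^ 2 := Finset.sum_nonneg fun v _ => sq_nonneg _
  linarith

omit [DecidableEq V] in
lemma continuous_load (v : V) : Continuous fun f : V → V → ℝ => load f v := by
  unfold load
  fun_prop

omit [DecidableEq V] in
lemma continuous_phiSq : Continuous (phiSq : (V → V → ℝ) → ℝ) := by
  unfold phiSq
  exact continuous_finsetSum _ fun v _ => (continuous_load v).pow 2

lemma continuous_stepC (p : V × V) : Continuous fun f : V → V → ℝ => stepC f p := by
  have hd : Continuous fun f : V → V → ℝ => clampD f p := by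
    unfold clampD
    have h1 := continuous_load p.1
    have h2 := continuous_load p.2
    fun_prop
  refine continuous_pi fun x => continuous_pi fun y => ?_
  unfold stepC lowdTransfer
  split_ifs <;> fun_prop

lemma continuous_fold (es : List (V × V)) :
    Continuous fun f : V → V → ℝ => es.foldl stepC f := by
  induction es with
  | nil => exact continuous_id
  | cons p es ih => exact ih.comp (continuous_stepC p)

/-- Running LOWD from the equal-split initialization, the value
`Σ_v ℓ_v²` after `t` iterations converges, as `t → ∞`, to the minimum of
`Σ_v ℓ_v(f)²` over all edge-weight distributions `f`. -/
theorem lowd_sum_sq_loads_tendsto_min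
    (w : V → V → ℝ)
    (hsymm : ∀ u v, w u v = w v u)
    (hnonneg : ∀ u v, 0 ≤ w u v)
    (hdiag : ∀ v, w v v = 0)
    (es : List (V × V)) (hes : EnumeratesEdges w es)
    (qmin : ℝ)
    (hq : IsLeast {q : ℝ | ∃ f : V → V → ℝ, IsDistrib w f ∧ ∑ v, (load f v) ^ 2 = q} qmin) :
    Filter.Tendsto (fun t => ∑ v, (load (lowdSeq w es t) v) ^ 2)
      Filter.atTop (nhds qmin) := by
  obtain ⟨-, hpos, -, hall⟩ := hes
  have hne : ∀ p ∈ es, p.1 ≠ p.2 := fun p hp => (hpos p hp).1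
  change Filter.Tendsto (fun t => phiSq (lowdSeq w es t)) Filter.atTop (nhds qmin)
  have hsucc' : ∀ t, lowdSeq w es (t + 1) = es.foldl lowdStep (lowdSeq w es t) := fun t =>
    Function.iterate_succ_apply' _ _ _
  have hD : ∀ t, IsDistrib w (lowdSeq w es t) := by
    intro t
    induction t with
    | zero =>
      refine ⟨fun u v => ?_, fun u v => ?_⟩
      · exact div_nonneg (hnonneg u v) (by norm_num)
      · change w u v / 2 + w v u / 2 = w u v
        rw [hsymm v u]; ring
    | succ t ih =>
      rw [hsucc', fold_eq w es hne _ ih]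
      exact fold_distrib w es hne _ ih
  have hsucc : ∀ t, lowdSeq w es (t + 1) = es.foldl stepC (lowdSeq w es t) := fun t => by
    rw [hsucc', fold_eq w es hne _ (hD t)]
  have hanti : Antitone fun t => phiSq (lowdSeq w es t) := antitone_nat_of_succ_le fun t => by
    rw [hsucc]
    exact fold_phi_le w es hne _ (hD t)
  have hbdd : BddBelow (Set.range fun t => phiSq (lowdSeq w es t)) :=
    ⟨qmin, by rintro _ ⟨t, rfl⟩; exact hq.2 ⟨_, hD t, rfl⟩⟩
  have hlim := tendsto_atTop_ciInf hanti hbdd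
  generalize (⨅ t, phiSq (lowdSeq w es t)) = L at hlim
  have hmem : ∀ t, lowdSeq w es t ∈ Set.Icc (0 : V → V → ℝ) w := fun t =>
    ⟨fun u v => (hD t).1 u v, fun u v => by linarith [(hD t).1 v u, (hD t).2 u v]⟩
  obtain ⟨x, -, φ, hφ, hx⟩ := isCompact_Icc.tendsto_subseq hmem
  have hxuv : ∀ u v, Filter.Tendsto (fun k => lowdSeq w es (φ k) u v) Filter.atTop
      (nhds (x u v)) := fun u v => tendsto_pi_nhds.1 (tendsto_pi_nhds.1 hx u) v
  have hxD : IsDistrib w x := by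
    refine ⟨fun u v => ge_of_tendsto' (hxuv u v) fun k => (hD _).1 u v, fun u v => ?_⟩
    refine tendsto_nhds_unique ((hxuv u v).add (hxuv v u)) ?_
    simp only [(hD _).2 u v]
    exact tendsto_const_nhds
  have hL1 : phiSq x = L := tendsto_nhds_unique
    ((continuous_phiSq.tendsto x).comp hx) (hlim.comp hφ.tendsto_atTop)
  have hL2 : phiSq (es.foldl stepC x) = L := by
    refine tendsto_nhds_unique
      (((continuous_phiSq.comp (continuous_fold es)).tendsto x).comp hx) ?_
    have := (hlim.comp (Filter.tendsto_add_atTop_nat 1)).comp hφ.tendsto_atTop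
    refine this.congr fun k => ?_
    simp only [Function.comp_apply, hsucc]
  have hst := fold_phi_eq w es hne x hxD (hL2.trans hL1.symm)
  have hstable : ∀ u v, load x v < load x u → x u v = 0 := by
    intro u v h
    have huv : u ≠ v := by rintro rfl; exact lt_irrefl _ h
    rcases (hnonneg u v).lt_or_eq with hw | hw
    · rcases hall u v huv hw with hm | hm
      · exact (clampD_zero x hxD.1 _ (hst _ hm)).1 h
      · exact (clampD_zero x hxD.1 _ (hst _ hm)).2 h
    · linarith [hxD.1 u v, hxD.1 v u, hxD.2 u v]
  obtain ⟨⟨g, hg, hgq⟩, hmin⟩ := hq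
  have h1 : phiSq x ≤ qmin := hgq ▸ opt_of_stable w x g hxD hg hstable
  have h2 : qmin ≤ phiSq x := hmin ⟨x, hxD, rfl⟩
  have : L = qmin := by linarith
  exact this ▸ hlim
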